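/- Let 𝐀 be a regular BBL transformation of bandwidth (p,q) on V_d^S with symbol A(w,w⁻¹), and let z_ℓ be a nonzero root of w^{−dp} det A(w,w⁻¹) of multiplicity s_ℓ. Then dim Ker A(z_ℓ, z_ℓ⁻¹) ≤ s_ℓ, where A(z_ℓ, z_ℓ⁻¹) ∈ M_d(ℂ) is the evaluation of the symbol at z_ℓ. Moreover, if dim Ker A(z_ℓ, z_ℓ⁻¹) = s_ℓ, then Ker 𝐀 ∩ T_{z_ℓ, s_ℓ} = Span{Φ_{z_ℓ,1}|u⟩ : u ∈ Ker A(z_ℓ, z_ℓ⁻¹)}, i.e. every kernel vector of 𝐀 in T_{z_ℓ,s_ℓ} is a purely exponential sequence {z_ℓ^j u}_{j∈ℤ}. -/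

import Mathlib

noncomputable section

/-- The space of doubly-infinite sequences with values in `ℂ^d`. -/
abbrev SeqSp (d : ℕ) : Type := ℤ → Fin d → ℂ

/-- The shift `(Ψ_j)_j ↦ (Ψ_{j+n})_j`; for `n = 1` this is the left shift `T`. -/
def shiftBy (d : ℕ) (n : ℤ) : Module.End ℂ (SeqSp d) where
  toFun Ψ := fun j => Ψ (j + n)
  map_add' _ _ := rfl
  map_smul' _ _ := rfl

/-- Entrywise multiplication of a sequence by a fixed `d × d` matrix. -/
def matOp (d : ℕ) (m : Matrix (Fin d) (Fin d) ℂ) : Module.End ℂ (SeqSp d) where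
  toFun Ψ := fun j => m.mulVec (Ψ j)
  map_add' Ψ Φ := by funext j; simp [Matrix.mulVec_add]
  map_smul' c Ψ := by funext j; simp [Matrix.mulVec_smul]

/-- The banded block-Laurent (BBL) transformation `(𝐀Ψ)_j = ∑_{r=p}^{q} a_r ψ_{j+r}`. -/
def bbl (d : ℕ) (a : ℤ → Matrix (Fin d) (Fin d) ℂ) (p q : ℤ) : Module.End ℂ (SeqSp d) :=
  ∑ r ∈ Finset.Icc p q, matOp d (a r) * shiftBy d r

/-- The projection `P_S` replacing every entry with index outside `S` by zero. -/
def projOn (d : ℕ) (S : Set ℤ) : Module.End ℂ (SeqSp d) where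
  toFun Ψ := fun j => S.indicator Ψ j
  map_add' Ψ Φ := by
    funext j
    by_cases h : j ∈ S <;> simp [Set.indicator_apply, h]
  map_smul' c Ψ := by
    funext j
    by_cases h : j ∈ S <;> simp [Set.indicator_apply, h]

/-- The window `{j : ℤ | Lb ≤ j ≤ Rb}`, with possibly infinite endpoints. -/
def windowSet (Lb : WithBot ℤ) (Rb : WithTop ℤ) : Set ℤ :=
  {j : ℤ | Lb ≤ (j : WithBot ℤ) ∧ (j : WithTop ℤ) ≤ Rb}

/-- Sequences supported in `S` (vanishing at every index outside `S`): the space `V_{L,R}`. -/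
def suppIn (d : ℕ) (S : Set ℤ) : Submodule ℂ (SeqSp d) where
  carrier := {Ψ | ∀ j ∉ S, Ψ j = 0}
  add_mem' := by
    intro Ψ Φ hΨ hΦ j hj
    simp [Pi.add_apply, hΨ j hj, hΦ j hj]
  zero_mem' := fun j _ => rfl
  smul_mem' := by
    intro c Ψ hΨ j hj
    simp [Pi.smul_apply, hΨ j hj]

/-- Sequences vanishing at every index of `S`. -/
def vanishOn (d : ℕ) (S : Set ℤ) : Submodule ℂ (SeqSp d) where
  carrier := {Ψ | ∀ j ∈ S, Ψ j = 0}
  add_mem' := by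
    intro Ψ Φ hΨ hΦ j hj
    simp [Pi.add_apply, hΨ j hj, hΦ j hj]
  zero_mem' := fun j _ => rfl
  smul_mem' := by
    intro c Ψ hΨ j hj
    simp [Pi.smul_apply, hΨ j hj]

/-- The bulk solution space `M_{Lb,Rb} = Ker (P_{Lb−p',Rb−q'} 𝐀 |_{V_{Lb,Rb}})`, viewed as a
submodule of the full sequence space: sequences supported in the window `[Lb,Rb]` whose image
under `𝐀` vanishes on the bulk window `[Lb−p', Rb−q']` (with `p' = min p 0`, `q' = max q 0`). -/
def bulkSol (d : ℕ) (a : ℤ → Matrix (Fin d) (Fin d) ℂ) (p q : ℤ)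
    (Lb : WithBot ℤ) (Rb : WithTop ℤ) : Submodule ℂ (SeqSp d) :=
  suppIn d (windowSet Lb Rb) ⊓
    (vanishOn d (windowSet (Lb + ((-min p 0 : ℤ) : WithBot ℤ))
        (Rb + ((-max q 0 : ℤ) : WithTop ℤ)))).comap (bbl d a p q)

/-- Falling-factorial type product `j^{(v)} = (j−v+1)(j−v+2)⋯j`. -/
def ff (j : ℤ) (v : ℕ) : ℤ := ∏ i ∈ Finset.range v, (j - i)

/-- The scalar sequence `Φ_{z,v}`, with `j`-th entry `j^{(v−1)} z^{j−v+1}`, and `Φ_{z,0} = 0`. -/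
def Phi (z : ℂ) (v : ℕ) : ℤ → ℂ :=
  fun j => if v = 0 then 0 else (ff j (v - 1) : ℂ) * z ^ (j - (v : ℤ) + 1)

/-- The vector sequence `Φ_{z,v}|m⟩`. -/
def PhiVec (d : ℕ) (z : ℂ) (v : ℕ) (m : Fin d) : SeqSp d :=
  fun j => Phi z v j • (Pi.single m 1 : Fin d → ℂ)

/-- The subspace `T_{z,s} = Span{Φ_{z,v}|m⟩ : 1 ≤ v ≤ s, 1 ≤ m ≤ d}`. -/
def Tspace (d : ℕ) (z : ℂ) (s : ℕ) : Submodule ℂ (SeqSp d) :=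
  Submodule.span ℂ {Ψ : SeqSp d | ∃ v ∈ Finset.Icc 1 s, ∃ m : Fin d, Ψ = PhiVec d z v m}

/-- The symbol `A(w,w⁻¹) = ∑_{r=p}^q w^r a_r` as a matrix of Laurent polynomials. -/
def symbol (d : ℕ) (a : ℤ → Matrix (Fin d) (Fin d) ℂ) (p q : ℤ) :
    Matrix (Fin d) (Fin d) (LaurentPolynomial ℂ) :=
  ∑ r ∈ Finset.Icc p q, (LaurentPolynomial.T r : LaurentPolynomial ℂ) • (a r).map (fun c => LaurentPolynomial.C c)

/-- The evaluation `A(z,z⁻¹) = ∑_{r=p}^q z^r a_r` of the symbol at `z ≠ 0`. -/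
def symbolEval (d : ℕ) (a : ℤ → Matrix (Fin d) (Fin d) ℂ) (p q : ℤ) (z : ℂ) :
    Matrix (Fin d) (Fin d) ℂ :=
  ∑ r ∈ Finset.Icc p q, z ^ r • a r

/-- The `k`-th derivative `A^{(k)}(z,z⁻¹) = ∑_{r=p}^q r(r−1)⋯(r−k+1) z^{r−k} a_r`. -/
def symbolDeriv (d : ℕ) (a : ℤ → Matrix (Fin d) (Fin d) ℂ) (p q : ℤ) (k : ℕ) (z : ℂ) :
    Matrix (Fin d) (Fin d) ℂ :=
  ∑ r ∈ Finset.Icc p q, ((ff r k : ℂ) * z ^ (r - (k : ℤ))) • a r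

/-- The generalized kernel `⋃_k Ker (f^k)` of an endomorphism. -/
def genKer (d : ℕ) (f : Module.End ℂ (SeqSp d)) : Submodule ℂ (SeqSp d) :=
  ⨆ k : ℕ, LinearMap.ker (f ^ k)

/-- `F_L^− `: the generalized kernel of the unilateral shift `P_{L,∞}T` on `M_{L,∞}`. -/
def Fminus (d : ℕ) (a : ℤ → Matrix (Fin d) (Fin d) ℂ) (p q : ℤ) (L : ℤ) :
    Submodule ℂ (SeqSp d) :=
  bulkSol d a p q (L : WithBot ℤ) ⊤ ⊓
    genKer d (projOn d (windowSet (L : WithBot ℤ) ⊤) * shiftBy d 1)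

/-- `F_R^+`: the generalized kernel of the shift `P_{−∞,R}T⁻¹` on `M_{−∞,R}`. -/
def Fplus (d : ℕ) (a : ℤ → Matrix (Fin d) (Fin d) ℂ) (p q : ℤ) (R : ℤ) :
    Submodule ℂ (SeqSp d) :=
  bulkSol d a p q ⊥ (R : WithTop ℤ) ⊓
    genKer d (projOn d (windowSet ⊥ (R : WithTop ℤ)) * shiftBy d (-1))

/-- The left shift on scalar sequences. -/
def shiftS : Module.End ℂ (ℤ → ℂ) where
  toFun φ := fun j => φ (j + 1)
  map_add' _ _ := rfl
  map_smul' _ _ := rfl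

/-- The linear map on `SeqSp d` induced by a diagonal matrix polynomial with diagonal entries
`g m`: it acts on the `m`-th component of a sequence as `g m` evaluated at the left shift. -/
def diagPolyOp (d : ℕ) (g : Fin d → Polynomial ℂ) : Module.End ℂ (SeqSp d) where
  toFun Ψ := fun j m => Polynomial.aeval shiftS (g m) (fun i => Ψ i m) j
  map_add' Ψ Φ := by
    funext j m
    show Polynomial.aeval shiftS (g m) ((fun i => Ψ i m) + (fun i => Φ i m)) j = _
    rw [map_add]
    rfl
  map_smul' c Ψ := by
    funext j m
    show Polynomial.aeval shiftS (g m) (c • (fun i => Ψ i m)) j = _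
    rw [map_smul]
    rfl

/-- The subspace of sequences with values in `Span{|m⟩ : d₀ < m ≤ d}` (the range of `ρ_d(π)`). -/
def piRange (d d₀ : ℕ) : Submodule ℂ (SeqSp d) where
  carrier := {Ψ | ∀ j : ℤ, ∀ m : Fin d, (m : ℕ) < d₀ → Ψ j m = 0}
  add_mem' := by
    intro Ψ Φ hΨ hΦ j m hm
    simp [Pi.add_apply, hΨ j m hm, hΦ j m hm]
  zero_mem' := fun j m _ => rfl
  smul_mem' := by
    intro c Ψ hΨ j m hm
    simp [Pi.smul_apply, hΨ j m hm]

/-- The Hilbert space `H` of square-summable half-infinite sequences, as a subspace of `SeqSp d`: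
sequences vanishing at indices `j ≤ 0` whose restriction to `j ≥ 1` is in `ℓ²`. -/
def Hspace (d : ℕ) : Submodule ℂ (SeqSp d) where
  carrier := {Ψ | (∀ j : ℤ, j ≤ 0 → Ψ j = 0) ∧ Memℓp (fun n : ℕ => Ψ ((n : ℤ) + 1)) 2}
  add_mem' := by
    intro Ψ Φ hΨ hΦ
    refine ⟨fun j hj => by simp [Pi.add_apply, hΨ.1 j hj, hΦ.1 j hj], ?_⟩
    exact hΨ.2.add hΦ.2
  zero_mem' := ⟨fun j _ => rfl, zero_memℓp⟩
  smul_mem' := by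
    intro c Ψ hΨ
    exact ⟨fun j hj => by simp [Pi.smul_apply, hΨ.1 j hj], hΨ.2.const_smul c⟩


open Polynomial in
/-- A polynomial matrix `B` factors, up to a constant invertible matrix on the right, through a
diagonal matrix with as many entries `X - z` as the dimension of the kernel of `B(z)`. -/
theorem exists_mul_diagonal_factorization {K n : Type*} [Field K] [Fintype n] [DecidableEq n]
    (B : Matrix n n K[X]) (z : K) :
    ∃ (U : Matrix n n K) (M : Matrix n n K[X]) (S : Finset n), IsUnit U ∧
      S.card = Module.finrank K (LinearMap.ker (B.map (eval z)).mulVecLin) ∧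
      B * U.map C = M * Matrix.diagonal (fun i => if i ∈ S then X - C z else 1) := by
  classical
  set N := LinearMap.ker (B.map (eval z)).mulVecLin
  let b := Module.finBasis K N
  have hli : LinearIndependent K (fun i => (b i : n → K)) :=
    b.linearIndependent.map' N.subtype (Submodule.ker_subtype N)
  let e := Module.Basis.sumExtend hli
  let σ := e.indexEquiv (Pi.basisFun K n)
  let c := e.reindex σ
  let S : Finset n := Finset.univ.image (fun i => σ (Sum.inl i))
  have hcS : ∀ j ∈ S, (B.map (eval z)).mulVec (c j) = 0 := by
    intro j hj
    obtain ⟨i, -, rfl⟩ := Finset.mem_image.1 hj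
    have h : c (σ (Sum.inl i)) = b i := by
      simp [c, e, Module.Basis.sumExtend]
      rfl
    rw [h]
    exact (b i).2
  let U : Matrix n n K := (Pi.basisFun K n).toMatrix c
  have hdvd : ∀ i, ∀ j ∈ S, (X - C z) ∣ (B * U.map C) i j := by
    intro i j hj
    rw [dvd_iff_isRoot, IsRoot.def, Matrix.mul_apply, eval_finsetSum]
    simpa [U, Matrix.mulVec, dotProduct, Module.Basis.toMatrix_apply] using congrFun (hcS j hj) i
  choose! Q hQ using hdvd
  refine ⟨U, Matrix.of fun i j => if j ∈ S then Q i j else (B * U.map C) i j, S, ?_, ?_, ?_⟩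
  · let := (Pi.basisFun K n).invertibleToMatrix c
    exact isUnit_of_invertible _
  · rw [Finset.card_image_of_injective _ (fun i j h => Sum.inl_injective (σ.injective h))]
    simp
  · ext1 i j
    rw [Matrix.mul_diagonal]
    by_cases hj : j ∈ S
    · simp [hj, hQ i j hj, mul_comm]
    · simp [hj]

open Polynomial in
theorem finrank_ker_eval_le_rootMultiplicity_det {K n : Type*} [Field K] [Fintype n]
    [DecidableEq n] (B : Matrix n n K[X]) (hB : B.det ≠ 0) (z : K) :
    Module.finrank K (LinearMap.ker (B.map (eval z)).mulVecLin) ≤ B.det.rootMultiplicity z := by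
  obtain ⟨U, M, S, hU, hS, h⟩ := exists_mul_diagonal_factorization B z
  have hUC : IsUnit (U.map (C : K →+* K[X])).det :=
    (Matrix.isUnit_iff_isUnit_det _).1 (hU.map (C : K →+* K[X]).mapMatrix)
  rw [le_rootMultiplicity_iff hB, ← hS, ← hUC.dvd_mul_right, ← Matrix.det_mul, h,
    Matrix.det_mul, Matrix.det_diagonal, Finset.prod_ite_mem]
  simp

open Polynomial in
/-- If the kernel of `B(z)` has the maximal possible dimension, then `B` has a left quasi-inverse
with only a simple factor `X - z`. -/
theorem exists_mul_eq_smul_one_of_finrank_ker_eq {K n : Type*} [Field K] [Fintype n]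
    [DecidableEq n] (B : Matrix n n K[X]) (hB : B.det ≠ 0) (z : K)
    (hk : Module.finrank K (LinearMap.ker (B.map (eval z)).mulVecLin) =
      B.det.rootMultiplicity z) :
    ∃ (E : Matrix n n K[X]) (g : K[X]), g.eval z ≠ 0 ∧ E * B = (g * (X - C z)) • 1 := by
  obtain ⟨U, M, S, hU, hS, h⟩ := exists_mul_diagonal_factorization B z
  have hUC : IsUnit (U.map (C : K →+* K[X])) := hU.map (C : K →+* K[X]).mapMatrix
  have hUd := (Matrix.isUnit_iff_isUnit_det _).1 hUC
  refine ⟨U.map C * Matrix.diagonal (fun i => if i ∈ S then 1 else X - C z) * M.adjugate,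
    M.det, ?_, ?_⟩
  · intro h0
    have hd : (X - C z) ^ (S.card + 1) ∣ B.det := by
      rw [← hUd.dvd_mul_right, ← Matrix.det_mul, h, Matrix.det_mul, Matrix.det_diagonal,
        Finset.prod_ite_mem, pow_succ', Finset.univ_inter, Finset.prod_const]
      exact mul_dvd_mul_right (dvd_iff_isRoot.2 h0) _
    rw [← le_rootMultiplicity_iff hB] at hd
    omega
  · rw [← hUC.mul_left_inj]
    have hD : Matrix.diagonal (fun i => if i ∈ S then 1 else X - C z) *
        Matrix.diagonal (fun i => if i ∈ S then X - C z else 1) =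
          (X - C z) • (1 : Matrix n n K[X]) := by
      rw [Matrix.diagonal_mul_diagonal, ← Matrix.diagonal_one, ← Matrix.diagonal_smul]
      congr 1
      ext1 i
      by_cases hi : i ∈ S <;> simp [hi]
    rw [Matrix.mul_assoc, h, Matrix.mul_assoc, ← Matrix.mul_assoc M.adjugate, Matrix.adjugate_mul,
      Matrix.smul_mul, Matrix.one_mul, Matrix.mul_smul, Matrix.mul_assoc, hD]
    simp [smul_smul]

open Polynomial in
/-- The polynomial matrix `w^{-p} A(w, w⁻¹)`. -/
def symbolPoly (d : ℕ) (a : ℤ → Matrix (Fin d) (Fin d) ℂ) (p q : ℤ) :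
    Matrix (Fin d) (Fin d) ℂ[X] :=
  fun i m => ∑ r ∈ Finset.Icc p q, C (a r i m) * X ^ (r - p).toNat

open Polynomial in
theorem symbolPoly_map_eval (d : ℕ) (a : ℤ → Matrix (Fin d) (Fin d) ℂ) (p q : ℤ) {z : ℂ}
    (hz : z ≠ 0) :
    (symbolPoly d a p q).map (eval z) = z ^ (-p) • symbolEval d a p q z := by
  ext i m
  simp only [Matrix.map_apply, symbolPoly, symbolEval, eval_finsetSum, Matrix.smul_apply,
    Matrix.sum_apply, Finset.mul_sum, smul_eq_mul, eval_mul, eval_C, eval_pow, eval_X]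
  refine Finset.sum_congr rfl fun r hr => ?_
  have hr' : ((r - p).toNat : ℤ) = -p + r := by
    have := (Finset.mem_Icc.1 hr).1
    omega
  rw [← zpow_natCast, hr', zpow_add₀ hz]
  ring

open Polynomial in
theorem det_symbolPoly_eq (d : ℕ) (a : ℤ → Matrix (Fin d) (Fin d) ℂ) (p q : ℤ) (P : ℂ[X])
    (hP : ∀ z : ℂ, z ≠ 0 → P.eval z = z ^ (-((d : ℤ) * p)) * (symbolEval d a p q z).det) :
    (symbolPoly d a p q).det = P := by
  refine eq_of_infinite_eval_eq _ _ ((Set.finite_singleton (0 : ℂ)).infinite_compl.mono ?_)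
  intro z hz
  have hz : z ≠ 0 := hz
  have h : (symbolPoly d a p q).det.eval z = ((symbolPoly d a p q).map (eval z)).det :=
    RingHom.map_det (evalRingHom z) _
  rw [Set.mem_ofPred_eq, h, symbolPoly_map_eval d a p q hz, Matrix.det_smul, hP z hz,
    Fintype.card_fin, ← zpow_natCast, ← zpow_mul]
  congr 2
  ring

theorem ker_mulVecLin_smul {K n : Type*} [Field K] [Fintype n] (A : Matrix n n K) {c : K}
    (hc : c ≠ 0) : LinearMap.ker (c • A).mulVecLin = LinearMap.ker A.mulVecLin := by
  ext v
  simp [hc]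

theorem bbl_apply (d : ℕ) (a : ℤ → Matrix (Fin d) (Fin d) ℂ) (p q : ℤ) (Ψ : SeqSp d) (j : ℤ)
    (i : Fin d) :
    bbl d a p q Ψ j i = ∑ r ∈ Finset.Icc p q, ∑ m, a r i m * Ψ (j + r) m := by
  simp [bbl, matOp, shiftBy, Matrix.mulVec, dotProduct, LinearMap.sum_apply, Finset.sum_apply]

theorem bbl_geometric (d : ℕ) (a : ℤ → Matrix (Fin d) (Fin d) ℂ) (p q : ℤ) {z : ℂ} (hz : z ≠ 0)
    (u : Fin d → ℂ) (j : ℤ) :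
    bbl d a p q (fun j => z ^ j • u) j = z ^ j • (symbolEval d a p q z).mulVec u := by
  ext i
  rw [bbl_apply]
  simp only [symbolEval, Matrix.sum_mulVec, Finset.sum_apply, Pi.smul_apply, smul_eq_mul,
    Finset.mul_sum, Matrix.smul_mulVec, Matrix.mulVec, dotProduct]
  refine Finset.sum_congr rfl fun r _ => Finset.sum_congr rfl fun m _ => ?_
  rw [zpow_add₀ hz]
  ring

theorem Phi_one (z : ℂ) (j : ℤ) : Phi z 1 j = z ^ j := by
  simp [Phi, ff]

theorem shiftS_pow_apply (n : ℕ) (φ : ℤ → ℂ) (j : ℤ) : (shiftS ^ n) φ j = φ (j + n) := by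
  induction n generalizing j with
  | zero => simp
  | succ n ih =>
    rw [pow_succ', Module.End.mul_apply]
    change (shiftS ^ n) φ (j + 1) = _
    rw [ih]
    congr 1
    push_cast
    ring

open Polynomial in
theorem sum_aeval_shiftS_symbolPoly (d : ℕ) (a : ℤ → Matrix (Fin d) (Fin d) ℂ) (p q : ℤ)
    (Ψ : SeqSp d) (i : Fin d) (j : ℤ) :
    (∑ m, aeval shiftS (symbolPoly d a p q i m) (fun l => Ψ l m)) j =
      bbl d a p q Ψ (j - p) i := by
  rw [bbl_apply, Finset.sum_comm, Finset.sum_apply]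
  refine Finset.sum_congr rfl fun m _ => ?_
  simp only [symbolPoly, map_sum, map_mul, aeval_C, map_pow, aeval_X, LinearMap.sum_apply,
    Finset.sum_apply, Module.End.mul_apply, Module.algebraMap_end_apply, Pi.smul_apply,
    smul_eq_mul, shiftS_pow_apply]
  refine Finset.sum_congr rfl fun r hr => ?_
  have := (Finset.mem_Icc.1 hr).1
  congr 2
  omega

open Polynomial in
/-- A left multiple of the symbol which is scalar annihilates every component of a kernel
vector. -/
theorem aeval_shiftS_eq_zero_of_mem_ker_bbl {d : ℕ} {a : ℤ → Matrix (Fin d) (Fin d) ℂ} {p q : ℤ}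
    {E : Matrix (Fin d) (Fin d) ℂ[X]} {f : ℂ[X]} (hE : E * symbolPoly d a p q = f • 1)
    {Ψ : SeqSp d} (hΨ : bbl d a p q Ψ = 0) (k : Fin d) :
    aeval shiftS f (fun l => Ψ l k) = 0 := by
  have h0 : ∀ i, ∑ m, aeval shiftS (symbolPoly d a p q i m) (fun l => Ψ l m) = 0 := by
    intro i
    funext j
    rw [sum_aeval_shiftS_symbolPoly, hΨ]
    rfl
  have h1 : ∑ m, aeval shiftS ((E * symbolPoly d a p q) k m) (fun l => Ψ l m) = 0 := by
    simp only [Matrix.mul_apply, map_sum, map_mul, LinearMap.sum_apply, Module.End.mul_apply]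
    rw [Finset.sum_comm]
    simp only [← map_sum, h0, map_zero, Finset.sum_const_zero]
  rw [hE, Finset.sum_eq_single k] at h1
  · simpa using h1
  · intro m _ hm
    simp [Matrix.one_apply_ne' hm]
  · simp

theorem ff_add_one_sub (j : ℤ) (v : ℕ) : ff (j + 1) (v + 1) - ff j (v + 1) = (v + 1) * ff j v := by
  have h1 : ff (j + 1) (v + 1) = ff j v * (j + 1) := by
    simp only [ff, Finset.prod_range_succ']
    simp
  have h2 : ff j (v + 1) = ff j v * (j - v) := Finset.prod_range_succ _ _
  rw [h1, h2]
  ring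

open Polynomial in
theorem aeval_shiftS_Phi_succ {z : ℂ} (hz : z ≠ 0) (v : ℕ) :
    aeval shiftS (X - C z) (Phi z (v + 1)) = (v : ℂ) • Phi z v := by
  funext j
  have h : aeval shiftS (X - C z) (Phi z (v + 1)) j =
      Phi z (v + 1) (j + 1) - z * Phi z (v + 1) j := by
    simp [shiftS]
  rw [h]
  cases v with
  | zero =>
    simp [Phi, ff, zpow_add₀ hz]
    ring
  | succ v =>
    have hff : (ff (j + 1) (v + 1) : ℂ) - ff j (v + 1) = (v + 1) * ff j v := by
      exact_mod_cast congrArg (Int.cast : ℤ → ℂ) (ff_add_one_sub j v)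
    have e1 : j + 1 - ((v + 1 + 1 : ℕ) : ℤ) + 1 = j - v := by push_cast; ring
    have e2 : j - ((v + 1 + 1 : ℕ) : ℤ) + 1 = j - v - 1 := by push_cast; ring
    have e3 : j - ((v + 1 : ℕ) : ℤ) + 1 = j - v := by push_cast; ring
    have e4 : z * z ^ (j - v - 1) = z ^ (j - v) := by
      rw [← zpow_one_add₀ hz]
      congr 1
      ring
    simp only [Phi, e1, e2, e3, Nat.add_one_ne_zero, if_false, Nat.add_sub_cancel, Pi.smul_apply,
      smul_eq_mul]
    push_cast
    linear_combination z ^ (j - v) * hff - (ff j (v + 1) : ℂ) * e4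

open Polynomial in
theorem aeval_shiftS_pow_Phi {z : ℂ} (hz : z ≠ 0) {v s : ℕ} (h : v ≤ s) :
    aeval shiftS ((X - C z) ^ s) (Phi z v) = 0 := by
  induction s generalizing v with
  | zero =>
    funext j
    simp [Phi, Nat.le_zero.1 h]
  | succ s ih =>
    cases v with
    | zero =>
      have : Phi z 0 = 0 := by funext j; simp [Phi]
      rw [this, map_zero]
    | succ v =>
      rw [pow_succ, map_mul, Module.End.mul_apply, aeval_shiftS_Phi_succ hz, map_smul,
        ih (Nat.le_of_succ_le_succ h), smul_zero]

open Polynomial in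
theorem aeval_shiftS_pow_of_mem_Tspace {d : ℕ} {z : ℂ} (hz : z ≠ 0) {s : ℕ} {Ψ : SeqSp d}
    (hΨ : Ψ ∈ Tspace d z s) (k : Fin d) :
    aeval shiftS ((X - C z) ^ s) (fun l => Ψ l k) = 0 := by
  induction hΨ using Submodule.span_induction with
  | mem Ψ h =>
    obtain ⟨v, hv, m, rfl⟩ := h
    have : (fun l => PhiVec d z v m l k) = (Pi.single m 1 : Fin d → ℂ) k • Phi z v := by
      funext l
      simp [PhiVec, mul_comm]
    rw [this, map_smul, aeval_shiftS_pow_Phi hz (Finset.mem_Icc.1 hv).2, smul_zero]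
  | zero => exact map_zero _
  | add Ψ Φ _ _ h1 h2 =>
    change aeval shiftS ((X - C z) ^ s) ((fun l => Ψ l k) + fun l => Φ l k) = 0
    rw [map_add, h1, h2, add_zero]
  | smul c Ψ _ h =>
    change aeval shiftS ((X - C z) ^ s) (c • fun l => Ψ l k) = 0
    rw [map_smul, h, smul_zero]

theorem eq_zpow_mul_of_succ {z : ℂ} (hz : z ≠ 0) {φ : ℤ → ℂ} (h : ∀ j, φ (j + 1) = z * φ j)
    (j : ℤ) : φ j = z ^ j * φ 0 := by
  induction j using Int.induction_on with
  | zero => simp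
  | succ j ih => rw [h, ih, zpow_add_one₀ hz]; ring
  | pred j ih =>
    have h' := h (-j - 1)
    rw [sub_add_cancel, ih] at h'
    apply mul_left_cancel₀ hz
    rw [← h', ← mul_assoc, ← zpow_one_add₀ hz]
    congr 2
    ring

theorem geometric_mem_Tspace {d : ℕ} (z : ℂ) {s : ℕ} (hs : 1 ≤ s) (u : Fin d → ℂ) :
    (fun j => Phi z 1 j • u) ∈ Tspace d z s := by
  have : (fun j => Phi z 1 j • u) = ∑ m, u m • PhiVec d z 1 m := by
    ext j m
    simp [PhiVec, Finset.sum_apply, Pi.single_apply, mul_comm]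
  rw [this]
  exact Submodule.sum_mem _ fun m _ => Submodule.smul_mem _ _
    (Submodule.subset_span ⟨1, Finset.mem_Icc.2 ⟨le_rfl, hs⟩, m, rfl⟩)

theorem stmt_10 (d : ℕ) (hd : 1 ≤ d) (p q : ℤ) (hpq : p ≤ q)
    (a : ℤ → Matrix (Fin d) (Fin d) ℂ) (hap : a p ≠ 0) (haq : a q ≠ 0)
    (hreg : (symbol d a p q).det ≠ 0)
    (P : Polynomial ℂ) (hP0 : P ≠ 0)
    (hP : ∀ z : ℂ, z ≠ 0 → P.eval z = z ^ (-((d : ℤ) * p)) * (symbolEval d a p q z).det)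
    (zl : ℂ) (hzl : zl ≠ 0) (hroot : P.IsRoot zl)
    (sl : ℕ) (hsl : sl = P.rootMultiplicity zl) :
    Module.finrank ℂ ↥(LinearMap.ker (symbolEval d a p q zl).mulVecLin) ≤ sl ∧
    (Module.finrank ℂ ↥(LinearMap.ker (symbolEval d a p q zl).mulVecLin) = sl →
      LinearMap.ker (bbl d a p q) ⊓ Tspace d zl sl
        = Submodule.span ℂ {Ψ : SeqSp d | ∃ u : Fin d → ℂ,
            (symbolEval d a p q zl).mulVec u = 0 ∧ Ψ = fun j => Phi zl 1 j • u}) := by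
  have hdet : (symbolPoly d a p q).det = P := det_symbolPoly_eq d a p q P hP
  have hB0 : (symbolPoly d a p q).det ≠ 0 := by rwa [hdet]
  have hker : LinearMap.ker ((symbolPoly d a p q).map (Polynomial.eval zl)).mulVecLin =
      LinearMap.ker (symbolEval d a p q zl).mulVecLin := by
    rw [symbolPoly_map_eval d a p q hzl, ker_mulVecLin_smul _ (zpow_ne_zero _ hzl)]
  have hs : 1 ≤ sl := hsl ▸ (Polynomial.rootMultiplicity_pos hP0).2 hroot
  rw [← hker, hsl, ← hdet]
  refine ⟨finrank_ker_eval_le_rootMultiplicity_det _ hB0 zl, fun hk => ?_⟩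
  obtain ⟨E, g, hg, hE⟩ := exists_mul_eq_smul_one_of_finrank_ker_eq _ hB0 zl hk
  rw [hdet, ← hsl]
  apply le_antisymm
  · rintro Ψ ⟨hΨ, hT⟩
    rw [SetLike.mem_coe, LinearMap.mem_ker] at hΨ
    have hcop : IsCoprime g ((Polynomial.X - Polynomial.C zl) ^ sl) :=
      (((Polynomial.irreducible_X_sub_C zl).coprime_iff_not_dvd).2
        (fun h => hg (Polynomial.dvd_iff_isRoot.1 h))).symm.pow_right
    obtain ⟨x, y, hxy⟩ := hcop
    have hshift : ∀ k j, Ψ (j + 1) k = zl * Ψ j k := by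
      intro k j
      have h1 := aeval_shiftS_eq_zero_of_mem_ker_bbl hE hΨ k
      have h2 := aeval_shiftS_pow_of_mem_Tspace hzl hT k
      have h3 : Polynomial.aeval shiftS (Polynomial.X - Polynomial.C zl) (fun l => Ψ l k) = 0 := by
        have : (Polynomial.X - Polynomial.C zl) =
            x * (g * (Polynomial.X - Polynomial.C zl)) +
              (Polynomial.X - Polynomial.C zl) * y * (Polynomial.X - Polynomial.C zl) ^ sl := by
          linear_combination -(Polynomial.X - Polynomial.C zl) * hxy
        rw [this, map_add, map_mul _ x, map_mul _ (_ * y), LinearMap.add_apply,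
          Module.End.mul_apply, Module.End.mul_apply, h1, h2, map_zero, map_zero, add_zero]
      simpa [shiftS, sub_eq_zero] using congrFun h3 j
    have hgeo : Ψ = fun j => zl ^ j • Ψ 0 := by
      ext j k
      exact eq_zpow_mul_of_succ (φ := fun l => Ψ l k) hzl (hshift k) j
    refine Submodule.subset_span ⟨Ψ 0, ?_, ?_⟩
    · have h := congrFun hΨ 0
      rw [hgeo, bbl_geometric d a p q hzl] at h
      simpa using h
    · simpa only [Phi_one] using hgeo
  · rw [Submodule.span_le]
    rintro _ ⟨u, hu, rfl⟩
    refine ⟨?_, geometric_mem_Tspace zl hs u⟩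
    rw [SetLike.mem_coe, LinearMap.mem_ker]
    funext j
    simp only [Phi_one, bbl_geometric d a p q hzl, hu, smul_zero, Pi.zero_apply]

end
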